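/- β is the inverse of α: for every x ∈ ℝ one has β(α(x)) = x, and for every y ∈ ℝ one has α(β(y)) = y. -/

import Mathlib

/-- The truncated power nonlinearity `α`: `α(x) = |x|^{p-2}x` for `|x| ≤ M` and
`α(x) = (p-1)M^{p-2}x − (p-2)M^{p-1}·x/|x|` for `|x| > M`. -/
noncomputable def alphaFun (p M x : ℝ) : ℝ :=
  if |x| ≤ M then |x| ^ (p - 2) * x
  else (p - 1) * M ^ (p - 2) * x - (p - 2) * M ^ (p - 1) * (x / |x|)

/-- The inverse nonlinearity `β` (with `p' = p/(p-1)` and `k_A = M^{2-p}/(p-1)`):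
`β(0) = 0`, `β(y) = |y|^{p'-2}y` for `0 < |y| ≤ M^{p-1}`, and
`β(y) = k_A·(y + (p-2)M^{p-1}·y/|y|)` for `|y| > M^{p-1}`. -/
noncomputable def betaFun (p M y : ℝ) : ℝ :=
  if y = 0 then 0
  else if |y| ≤ M ^ (p - 1) then |y| ^ (p / (p - 1) - 2) * y
  else (M ^ (2 - p) / (p - 1)) * (y + (p - 2) * M ^ (p - 1) * (y / |y|))

theorem alphaFun_zero (p M : ℝ) : alphaFun p M 0 = 0 := by
  simp [alphaFun]

theorem betaFun_zero (p M : ℝ) : betaFun p M 0 = 0 := by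
  simp [betaFun]

theorem alphaFun_neg (p M x : ℝ) : alphaFun p M (-x) = -alphaFun p M x := by
  unfold alphaFun
  rw [abs_neg]
  split_ifs <;> ring

theorem betaFun_neg (p M y : ℝ) : betaFun p M (-y) = -betaFun p M y := by
  unfold betaFun
  rw [abs_neg]
  simp only [neg_eq_zero]
  split_ifs <;> ring

theorem alphaFun_of_pos_of_le {p M x : ℝ} (hx : 0 < x) (hxM : x ≤ M) :
    alphaFun p M x = x ^ (p - 1) := by
  rw [alphaFun, abs_of_pos hx, if_pos hxM, ← Real.rpow_add_one hx.ne']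
  ring_nf

theorem alphaFun_of_lt {p M x : ℝ} (hM : 0 < M) (hxM : M < x) :
    alphaFun p M x = M ^ (p - 1) + (p - 1) * M ^ (p - 2) * (x - M) := by
  have hx : 0 < x := hM.trans hxM
  have h : M ^ (p - 1) = M ^ (p - 2) * M := by
    rw [← Real.rpow_add_one hM.ne']
    ring_nf
  rw [alphaFun, abs_of_pos hx, if_neg hxM.not_ge, div_self hx.ne', h]
  ring

theorem betaFun_of_pos_of_le {p M y : ℝ} (hp : 2 < p) (hy : 0 < y) (hyM : y ≤ M ^ (p - 1)) :
    betaFun p M y = y ^ (p - 1)⁻¹ := by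
  have hp1 : p - 1 ≠ 0 := by linarith
  rw [betaFun, if_neg hy.ne', abs_of_pos hy, if_pos hyM, ← Real.rpow_add_one hy.ne']
  congr 1
  field_simp
  ring

theorem betaFun_of_lt {p M y : ℝ} (hp : 2 < p) (hM : 0 < M) (hyM : M ^ (p - 1) < y) :
    betaFun p M y = M + (y - M ^ (p - 1)) / ((p - 1) * M ^ (p - 2)) := by
  have hp1 : p - 1 ≠ 0 := by linarith
  have hy : 0 < y := (Real.rpow_pos_of_pos hM _).trans hyM
  have hc : M ^ (p - 2) ≠ 0 := (Real.rpow_pos_of_pos hM _).ne'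
  have h : M ^ (p - 1) = M ^ (p - 2) * M := by
    rw [← Real.rpow_add_one hM.ne']
    ring_nf
  have h' : M ^ (2 - p) = (M ^ (p - 2))⁻¹ := by
    rw [← Real.rpow_neg hM.le, neg_sub]
  rw [betaFun, if_neg hy.ne', abs_of_pos hy, if_neg hyM.not_ge, div_self hy.ne', h, h']
  field_simp
  ring

theorem betaFun_alphaFun_of_pos {p M x : ℝ} (hp : 2 < p) (hM : 0 < M) (hx : 0 < x) :
    betaFun p M (alphaFun p M x) = x := by
  have hp1 : 0 < p - 1 := by linarith
  have hc : 0 < (p - 1) * M ^ (p - 2) := mul_pos hp1 (Real.rpow_pos_of_pos hM _)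
  rcases le_or_gt x M with h | h
  · rw [alphaFun_of_pos_of_le hx h, betaFun_of_pos_of_le hp (Real.rpow_pos_of_pos hx _)
      (Real.rpow_le_rpow hx.le h hp1.le), Real.rpow_rpow_inv hx.le hp1.ne']
  · rw [alphaFun_of_lt hM h,
      betaFun_of_lt hp hM (lt_add_of_pos_right _ (mul_pos hc (sub_pos.2 h))),
      add_sub_cancel_left, mul_div_cancel_left₀ _ hc.ne', add_sub_cancel]

theorem alphaFun_betaFun_of_pos {p M y : ℝ} (hp : 2 < p) (hM : 0 < M) (hy : 0 < y) :
    alphaFun p M (betaFun p M y) = y := by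
  have hp1 : 0 < p - 1 := by linarith
  have hc : 0 < (p - 1) * M ^ (p - 2) := mul_pos hp1 (Real.rpow_pos_of_pos hM _)
  rcases le_or_gt y (M ^ (p - 1)) with h | h
  · rw [betaFun_of_pos_of_le hp hy h, alphaFun_of_pos_of_le (Real.rpow_pos_of_pos hy _)
      ((Real.rpow_inv_le_iff_of_pos hy.le hM.le hp1).2 h), Real.rpow_inv_rpow hy.le hp1.ne']
  · rw [betaFun_of_lt hp hM h,
      alphaFun_of_lt hM (lt_add_of_pos_right _ (div_pos (sub_pos.2 h) hc)),
      add_sub_cancel_left, mul_div_cancel₀ _ hc.ne', add_sub_cancel]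

theorem leftInverse_of_odd_of_pos {f g : ℝ → ℝ} (hf : ∀ x, f (-x) = -f x)
    (hg : ∀ x, g (-x) = -g x) (hf0 : f 0 = 0) (hg0 : g 0 = 0)
    (h : ∀ x, 0 < x → g (f x) = x) (x : ℝ) : g (f x) = x := by
  rcases lt_trichotomy x 0 with hx | rfl | hx
  · have := h (-x) (neg_pos.2 hx)
    rwa [hf, hg, neg_inj] at this
  · rw [hf0, hg0]
  · exact h x hx

theorem stmt6 (p M : ℝ) (hp : 2 < p) (hM : 0 < M) :
    (∀ x : ℝ, betaFun p M (alphaFun p M x) = x) ∧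
    (∀ y : ℝ, alphaFun p M (betaFun p M y) = y) := by
  exact ⟨leftInverse_of_odd_of_pos (alphaFun_neg p M) (betaFun_neg p M) (alphaFun_zero p M)
      (betaFun_zero p M) fun _ => betaFun_alphaFun_of_pos hp hM,
    leftInverse_of_odd_of_pos (betaFun_neg p M) (alphaFun_neg p M) (betaFun_zero p M)
      (alphaFun_zero p M) fun _ => alphaFun_betaFun_of_pos hp hM⟩
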